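/- The cumulative first-order error contribution is bounded by a universal constant: there exists a universal constant C₀ > 0 such that for every even n ≥ 2 and every d with 1 ≤ d ≤ 2^n, Σ_{l=1}^{d} E_{C∼RQC(n,l)} |⟨0^n| C† X₁ C |0^n⟩|² ≤ C₀, and moreover this sum is at least 1/5 (its l = 1 term). -/

import Mathlib

open MeasureTheory Matrix

noncomputable section

/-- Measurable structure on complex matrices (Borel of the product topology). -/
instance matMS (m n : Type*) [Fintype m] [Fintype n] : MeasurableSpace (Matrix m n ℂ) :=
  borel _

instance matBS (m n : Type*) [Fintype m] [Fintype n] : BorelSpace (Matrix m n ℂ) := ⟨rfl⟩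

/-- Computational basis labels of an `n`-qubit system. -/
abbrev QIdx (n : ℕ) := Fin n → Fin 2

/-- The single-qubit Pauli matrices `I, X, Y, Z`. -/
def Pauli : Fin 4 → Matrix (Fin 2) (Fin 2) ℂ
  | 0 => 1
  | 1 => !![0, 1; 1, 0]
  | 2 => !![0, -Complex.I; Complex.I, 0]
  | 3 => !![1, 0; 0, -1]

/-- The `n`-qubit Pauli string `σ_α = ⨂ᵢ Pauli (α i)`. -/
def pauliString {n : ℕ} (α : Fin n → Fin 4) : Matrix (QIdx n) (QIdx n) ℂ :=
  Matrix.of fun x y => ∏ i, Pauli (α i) (x i) (y i)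

/-- Pauli `X` acting on qubit `i` (identity elsewhere). -/
def pauliXat {n : ℕ} (i : Fin n) : Matrix (QIdx n) (QIdx n) ℂ :=
  pauliString (fun k => if k = i then 1 else 0)

/-- A two-qubit gate, as a matrix indexed by pairs of qubit basis labels. -/
abbrev Gate2 := Matrix (Fin 2 × Fin 2) (Fin 2 × Fin 2) ℂ

/-- Odd brickwork layer on `n = 2m` qubits: gates on pairs `(0,1), (2,3), …, (2m-2, 2m-1)`. -/
def layerOdd {m : ℕ} (g : Fin m → Gate2) : Matrix (QIdx (2 * m)) (QIdx (2 * m)) ℂ :=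
  Matrix.of fun x y => ∏ j : Fin m,
    g j (x ⟨2 * j.1, by have := j.2; omega⟩, x ⟨2 * j.1 + 1, by have := j.2; omega⟩)
        (y ⟨2 * j.1, by have := j.2; omega⟩, y ⟨2 * j.1 + 1, by have := j.2; omega⟩)

/-- Even brickwork layer on the ring of `n = 2m` qubits:
gates on pairs `(1,2), (3,4), …, (2m-1, 0)` (indices mod `2m`). -/
def layerEven {m : ℕ} (g : Fin m → Gate2) : Matrix (QIdx (2 * m)) (QIdx (2 * m)) ℂ :=
  Matrix.of fun x y => ∏ j : Fin m,
    g j (x ⟨2 * j.1 + 1, by have := j.2; omega⟩,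
         x ⟨(2 * j.1 + 2) % (2 * m), Nat.mod_lt _ (by have := j.2; omega)⟩)
        (y ⟨2 * j.1 + 1, by have := j.2; omega⟩,
         y ⟨(2 * j.1 + 2) % (2 * m), Nat.mod_lt _ (by have := j.2; omega)⟩)

/-- Layer `L_{t+1}` of the brickwork circuit (`t` is the 0-based layer index;
`L_1` is an odd layer, `L_2` an even layer, and so on, alternating). -/
def brickLayer {m : ℕ} (t : ℕ) (g : Fin m → Gate2) : Matrix (QIdx (2 * m)) (QIdx (2 * m)) ℂ :=
  if t % 2 = 0 then layerOdd g else layerEven g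

/-- An assignment of a two-qubit gate to each (layer, pair) position. -/
abbrev GateAssign (m d : ℕ) := Fin d → Fin m → Gate2

/-- The circuit `C = L_d ⋯ L_1` built from the gate assignment `G`. -/
def circuitOf {m d : ℕ} (G : GateAssign m d) : Matrix (QIdx (2 * m)) (QIdx (2 * m)) ℂ :=
  (List.finRange d).foldl (fun M t => brickLayer t.1 (G t) * M) 1

/-- The group of two-qubit unitary gates `U(4)`. -/
abbrev U4 := Matrix.unitaryGroup (Fin 2 × Fin 2) ℂ

/-- The gate assignment obtained from a point of the product sample space. -/
def gatesOf {m d : ℕ} (ω : Fin d × Fin m → U4) : GateAssign m d :=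
  fun t j => (ω (t, j) : Gate2)

/-- The basis label `0ⁿ` of `|0^n⟩`. -/
def allZero (n : ℕ) : QIdx n := fun _ => 0

/-- `⟨0^n| C† A C |0^n⟩` for an `n`-qubit matrix `A` and circuit `C`. -/
def zeroExp {n : ℕ} (C A : Matrix (QIdx n) (QIdx n) ℂ) : ℂ :=
  (Cᴴ * A * C) (allZero n) (allZero n)

end

noncomputable section

open scoped Kronecker

/-- The two-qubit Pauli operator `Pauli p.1 ⊗ Pauli p.2`. -/
def pauli2 (p : Fin 4 × Fin 4) : Gate2 := Pauli p.1 ⊗ₖ Pauli p.2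

lemma Pauli_conjTranspose (a : Fin 4) : (Pauli a)ᴴ = Pauli a := by
  fin_cases a <;> ext i j <;> fin_cases i <;> fin_cases j <;> simp [Pauli]

lemma Pauli_mul_self (a : Fin 4) : Pauli a * Pauli a = 1 := by
  fin_cases a <;> ext i j <;> fin_cases i <;> fin_cases j <;>
    simp [Pauli, Matrix.mul_apply, Fin.sum_univ_two]

/-- The sign relating `Pauli a * Pauli b` and `Pauli b * Pauli a`. -/
def commSign (a b : Fin 4) : ℤ := if a = 0 ∨ b = 0 ∨ a = b then 1 else -1

lemma Pauli_mul_comm_sign (a b : Fin 4) :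
    Pauli a * Pauli b = commSign a b • (Pauli b * Pauli a) := by
  fin_cases a <;> fin_cases b <;> ext i j <;> fin_cases i <;> fin_cases j <;>
    simp [Pauli, commSign, Matrix.mul_apply, Fin.sum_univ_two]

lemma sum_Pauli_mul_Pauli (a b c d : Fin 2) :
    ∑ p, Pauli p a b * Pauli p c d = if a = d ∧ b = c then 2 else 0 := by
  fin_cases a <;> fin_cases b <;> fin_cases c <;> fin_cases d <;>
    simp [Pauli, Fin.sum_univ_four] <;> norm_num

lemma pauli2_zero : pauli2 0 = 1 := by
  simp [pauli2, Pauli]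

lemma pauli2_conjTranspose (p : Fin 4 × Fin 4) : (pauli2 p)ᴴ = pauli2 p := by
  simp [pauli2, Matrix.conjTranspose_kronecker, Pauli_conjTranspose]

lemma pauli2_mul_self (p : Fin 4 × Fin 4) : pauli2 p * pauli2 p = 1 := by
  simp [pauli2, ← Matrix.mul_kronecker_mul, Pauli_mul_self]

lemma pauli2_mul_comm_sign (p q : Fin 4 × Fin 4) :
    pauli2 p * pauli2 q = (commSign p.1 q.1 * commSign p.2 q.2) • (pauli2 q * pauli2 p) := by
  simp only [pauli2, ← Matrix.mul_kronecker_mul]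
  rw [Pauli_mul_comm_sign p.1, Pauli_mul_comm_sign p.2, Matrix.smul_kronecker,
    Matrix.kronecker_smul, smul_smul]

lemma sum_pauli2_mul_pauli2 (a b c d : Fin 2 × Fin 2) :
    ∑ p, pauli2 p a b * pauli2 p c d = if a = d ∧ b = c then 4 else 0 := by
  have h : ∀ p : Fin 4 × Fin 4, pauli2 p a b * pauli2 p c d =
      (Pauli p.1 a.1 b.1 * Pauli p.1 c.1 d.1) * (Pauli p.2 a.2 b.2 * Pauli p.2 c.2 d.2) := by
    intro p
    simp only [pauli2, Matrix.kroneckerMap_apply]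
    ring
  simp_rw [h]
  rw [Fintype.sum_prod_type]
  simp_rw [← Finset.mul_sum, ← Finset.sum_mul, sum_Pauli_mul_Pauli]
  obtain ⟨a1, a2⟩ := a
  obtain ⟨b1, b2⟩ := b
  obtain ⟨c1, c2⟩ := c
  obtain ⟨d1, d2⟩ := d
  clear h
  simp only [Prod.mk.injEq]
  split_ifs <;> first | (norm_num; done) | (exfalso; grind)

lemma exists_anticommuting_chain (p q : Fin 4 × Fin 4) (hp : p ≠ 0) (hq : q ≠ 0) :
    ∃ r : Fin 4 × Fin 4, commSign p.1 r.1 * commSign p.2 r.2 = -1 ∧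
      commSign r.1 q.1 * commSign r.2 q.2 = -1 := by
  revert p q
  decide

lemma pauli2_mem_unitary (p : Fin 4 × Fin 4) :
    pauli2 p ∈ Matrix.unitaryGroup (Fin 2 × Fin 2) ℂ := by
  rw [Matrix.mem_unitaryGroup_iff, Matrix.star_eq_conjTranspose, pauli2_conjTranspose,
    pauli2_mul_self]

/-- The Pauli operator `pauli2 p` conjugated by a gate. -/
def conjPauli (p : Fin 4 × Fin 4) (U : Gate2) : Gate2 := Uᴴ * pauli2 p * U

lemma exists_unitary_conj {P Q : Gate2} (hP : Pᴴ = P) (hQ : Qᴴ = Q) (hPP : P * P = 1)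
    (hQQ : Q * Q = 1) (hPQ : P * Q = -(Q * P)) :
    ∃ V : U4, (V : Gate2)ᴴ * P * (V : Gate2) = Q := by
  have hs : ((Real.sqrt 2 : ℝ) : ℂ)⁻¹ * ((Real.sqrt 2 : ℝ) : ℂ)⁻¹ = 1 / 2 := by
    rw [← mul_inv, ← Complex.ofReal_mul, Real.mul_self_sqrt (by norm_num)]
    norm_num
  set s : ℂ := ((Real.sqrt 2 : ℝ) : ℂ)⁻¹ with hsdef
  have hstar : star s = s := by simp [hsdef]
  have hV : (s • (P + Q))ᴴ = s • (P + Q) := by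
    rw [Matrix.conjTranspose_smul, Matrix.conjTranspose_add, hP, hQ, hstar]
  refine ⟨⟨s • (P + Q), ?_⟩, ?_⟩
  · rw [Matrix.mem_unitaryGroup_iff, Matrix.star_eq_conjTranspose, hV, Matrix.smul_mul,
      Matrix.mul_smul, smul_smul, hs, add_mul, mul_add, mul_add, hPP, hQQ, hPQ]
    rw [show (1 + -(Q * P) + (Q * P + 1) : Gate2) = (2 : ℂ) • 1 by rw [two_smul]; abel, smul_smul]
    norm_num
  · change (s • (P + Q))ᴴ * P * (s • (P + Q)) = Q
    rw [hV, Matrix.smul_mul, Matrix.smul_mul, Matrix.mul_smul, smul_smul, hs]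
    have h : (P + Q) * P * (P + Q) = (2 : ℂ) • Q := by
      have h1 : Q * P * Q = -P := by
        rw [mul_assoc, hPQ, mul_neg, ← mul_assoc, hQQ, one_mul]
      rw [add_mul, add_mul, mul_add, mul_add, hPP, one_mul, one_mul, h1, mul_assoc, hPP, mul_one,
        two_smul]
      abel
    rw [h, smul_smul]
    norm_num

lemma conjPauli_mem_unitary (p : Fin 4 × Fin 4) (U : U4) :
    conjPauli p (U : Gate2) ∈ Matrix.unitaryGroup (Fin 2 × Fin 2) ℂ := by
  have := mul_mem (mul_mem (star U).2 (pauli2_mem_unitary p)) U.2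
  exact this

lemma measurable_gate_entry (a b : Fin 2 × Fin 2) : Measurable fun U : U4 => (U : Gate2) a b :=
  (continuous_subtype_val.matrix_elem a b).measurable

lemma measurable_conjPauli_entry (p : Fin 4 × Fin 4) (a b : Fin 2 × Fin 2) :
    Measurable fun U : U4 => conjPauli p (U : Gate2) a b := by
  have h : Continuous fun U : U4 => conjPauli p (U : Gate2) := by
    unfold conjPauli
    fun_prop
  exact (h.matrix_elem a b).measurable

lemma integrable_conjPauli_mul (μ : Measure U4) [IsProbabilityMeasure μ]
    (p : Fin 4 × Fin 4) (a b c d : Fin 2 × Fin 2) :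
    Integrable (fun U : U4 => conjPauli p (U : Gate2) a b * conjPauli p (U : Gate2) c d) μ := by
  refine Integrable.of_bound (C := 1)
    ((measurable_conjPauli_entry p a b).mul (measurable_conjPauli_entry p c d)).aestronglyMeasurable
    (Filter.Eventually.of_forall fun U => ?_)
  rw [norm_mul]
  exact mul_le_one₀ (entry_norm_bound_of_unitary (conjPauli_mem_unitary p U) a b) (norm_nonneg _)
    (entry_norm_bound_of_unitary (conjPauli_mem_unitary p U) c d)

lemma conjPauli_apply (p : Fin 4 × Fin 4) (U : Gate2) (a b : Fin 2 × Fin 2) :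
    conjPauli p U a b =
      ∑ x : (Fin 2 × Fin 2) × (Fin 2 × Fin 2), Uᴴ a x.1 * U x.2 b * pauli2 p x.1 x.2 := by
  simp only [conjPauli, Matrix.mul_apply, Finset.sum_mul]
  refine Eq.trans ?_ (Fintype.sum_prod_type_right _).symm
  refine Finset.sum_congr rfl fun j _ => ?_
  refine Finset.sum_congr rfl fun i _ => ?_
  ring

lemma sum_conjPauli_mul (U : U4) (a b c d : Fin 2 × Fin 2) :
    ∑ p, conjPauli p (U : Gate2) a b * conjPauli p (U : Gate2) c d =
      ∑ p, pauli2 p a b * pauli2 p c d := by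
  have hU : (U : Gate2)ᴴ * (U : Gate2) = 1 := Matrix.mem_unitaryGroup_iff'.mp U.2
  have hUad := congrFun (congrFun hU a) d
  have hUcb := congrFun (congrFun hU c) b
  rw [Matrix.mul_apply] at hUad hUcb
  simp_rw [conjPauli_apply, Finset.sum_mul_sum, mul_mul_mul_comm _ (pauli2 _ _ _)]
  rw [Finset.sum_comm]
  refine (Finset.sum_congr rfl fun x _ => Finset.sum_comm).trans ?_
  simp_rw [← Finset.mul_sum, sum_pauli2_mul_pauli2]
  have h : ∀ x y : (Fin 2 × Fin 2) × (Fin 2 × Fin 2),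
      (U : Gate2)ᴴ a x.1 * (U : Gate2) x.2 b * ((U : Gate2)ᴴ c y.1 * (U : Gate2) y.2 d) *
        (if x.1 = y.2 ∧ x.2 = y.1 then (4 : ℂ) else 0) =
      if y = x.swap then 4 * (((U : Gate2)ᴴ a x.1 * (U : Gate2) x.1 d) *
        ((U : Gate2)ᴴ c x.2 * (U : Gate2) x.2 b)) else 0 := by
    rintro ⟨x1, x2⟩ ⟨y1, y2⟩
    simp only [Prod.swap_prod_mk, Prod.mk.injEq]
    by_cases hxy : x1 = y2 ∧ x2 = y1
    · obtain ⟨rfl, rfl⟩ := hxy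
      simp only [and_self, if_true]
      ring
    · rw [if_neg hxy, if_neg (by tauto), mul_zero]
  simp_rw [h, Finset.sum_ite_eq', Finset.mem_univ, if_true, ← Finset.mul_sum]
  rw [Fintype.sum_prod_type' (f := fun i j => ((U : Gate2)ᴴ a i * (U : Gate2) i d) *
    ((U : Gate2)ᴴ c j * (U : Gate2) j b)), ← Finset.sum_mul_sum]
  rw [hUad, hUcb, Matrix.one_apply, Matrix.one_apply]
  split_ifs <;> first | (norm_num; done) | (exfalso; grind)

lemma integral_conjPauli_mul (μ : Measure U4) [μ.IsHaarMeasure] [IsProbabilityMeasure μ]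
    (p : Fin 4 × Fin 4) (hp : p ≠ 0) (a b c d : Fin 2 × Fin 2) :
    ∫ U : U4, conjPauli p (U : Gate2) a b * conjPauli p (U : Gate2) c d ∂μ =
      (1 / 15) * ∑ q ∈ Finset.univ.erase 0, pauli2 q a b * pauli2 q c d := by
  set F : Fin 4 × Fin 4 → ℂ := fun p =>
    ∫ U : U4, conjPauli p (U : Gate2) a b * conjPauli p (U : Gate2) c d ∂μ with hF
  have hanti : ∀ p q : Fin 4 × Fin 4, commSign p.1 q.1 * commSign p.2 q.2 = -1 → F p = F q := by
    intro p q h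
    obtain ⟨V, hV⟩ := exists_unitary_conj (pauli2_conjTranspose p) (pauli2_conjTranspose q)
      (pauli2_mul_self p) (pauli2_mul_self q) (by rw [pauli2_mul_comm_sign, h, neg_one_smul])
    simp only [hF]
    rw [← integral_mul_left_eq_self _ V]
    congr 1
    ext U
    have : conjPauli p ((V * U : U4) : Gate2) = conjPauli q (U : Gate2) := by
      rw [conjPauli, conjPauli, ← hV]
      simp only [Submonoid.coe_mul, Matrix.conjTranspose_mul, Matrix.mul_assoc]
    rw [this]
  have heq : ∀ q : Fin 4 × Fin 4, q ≠ 0 → F q = F p := by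
    intro q hq
    obtain ⟨r, h1, h2⟩ := exists_anticommuting_chain q p hq hp
    rw [hanti q r h1, hanti r p h2]
  have hsum : ∑ q, F q = ∑ q, pauli2 q a b * pauli2 q c d := by
    simp only [hF]
    rw [← integral_finsetSum _ fun q _ => integrable_conjPauli_mul μ q a b c d]
    simp_rw [sum_conjPauli_mul]
    simp
  have h0 : F 0 = pauli2 0 a b * pauli2 0 c d := by
    have : ∀ U : U4, conjPauli 0 (U : Gate2) = 1 := by
      intro U
      rw [conjPauli, pauli2_zero, mul_one]
      exact Matrix.mem_unitaryGroup_iff'.mp U.2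
    simp only [hF, this, pauli2_zero, integral_const, probReal_univ, one_smul]
  rw [← Finset.add_sum_erase _ _ (Finset.mem_univ 0),
    ← Finset.add_sum_erase _ _ (Finset.mem_univ 0), h0, add_right_inj,
    Finset.sum_congr rfl fun q hq => heq q (Finset.ne_of_mem_erase hq), Finset.sum_const] at hsum
  rw [← hsum]
  have hcard : (Finset.univ.erase (0 : Fin 4 × Fin 4)).card = 15 := by decide
  rw [hcard, nsmul_eq_mul]
  change F p = _
  push_cast
  ring

/-- Transition kernel on two-qubit Paulis induced by the second moment of a Haar-random gate. -/
def gateKer (p q : Fin 4 × Fin 4) : ℝ :=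
  if p = 0 then (if q = 0 then 1 else 0) else if q = 0 then 0 else 1 / 15

lemma integral_conjPauli_mul_eq_gateKer (μ : Measure U4) [μ.IsHaarMeasure]
    [IsProbabilityMeasure μ] (p : Fin 4 × Fin 4) (a b c d : Fin 2 × Fin 2) :
    ∫ U : U4, conjPauli p (U : Gate2) a b * conjPauli p (U : Gate2) c d ∂μ =
      ∑ q, (gateKer p q : ℂ) * (pauli2 q a b * pauli2 q c d) := by
  by_cases hp : p = 0
  · subst hp
    have : ∀ U : U4, conjPauli 0 (U : Gate2) = 1 := by
      intro U
      rw [conjPauli, pauli2_zero, mul_one]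
      exact Matrix.mem_unitaryGroup_iff'.mp U.2
    simp only [this, gateKer, if_true, integral_const, probReal_univ, one_smul]
    rw [Finset.sum_eq_single 0 (by simp +contextual) (by simp)]
    simp [pauli2_zero]
  · rw [integral_conjPauli_mul μ p hp, ← Finset.add_sum_erase _ _ (Finset.mem_univ 0),
      Finset.mul_sum]
    simp only [gateKer, if_neg hp, if_true, Complex.ofReal_zero, zero_mul, zero_add]
    refine Finset.sum_congr rfl fun q hq => ?_
    rw [if_neg (Finset.ne_of_mem_erase hq)]
    push_cast
    rfl

section Layer

variable {n m : ℕ}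

/-- Grouping the sites of `Fin n` into pairs turns a configuration on `Fin n` into a configuration
of pairs. -/
def pairEquiv (e : Fin m × Fin 2 ≃ Fin n) (A : Type*) : (Fin n → A) ≃ (Fin m → A × A) where
  toFun x j := (x (e (j, 0)), x (e (j, 1)))
  invFun y i := if (e.symm i).2 = 0 then (y (e.symm i).1).1 else (y (e.symm i).1).2
  left_inv x := by
    ext i
    obtain ⟨⟨j, b⟩, rfl⟩ := e.surjective i
    fin_cases b <;> simp
  right_inv y := by
    ext j <;> simp

lemma prod_pairs {M : Type*} [CommMonoid M] (e : Fin m × Fin 2 ≃ Fin n) (f : Fin n → M) :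
    ∏ i, f i = ∏ j, (f (e (j, 0)) * f (e (j, 1))) := by
  rw [← e.prod_comp, Fintype.prod_prod_type]
  simp_rw [Fin.prod_univ_two]

/-- The layer of gates `g j` acting on the pairs of sites `e (j, 0)`, `e (j, 1)`. -/
def pairLayer (e : Fin m × Fin 2 ≃ Fin n) (g : Fin m → Gate2) : Matrix (QIdx n) (QIdx n) ℂ :=
  Matrix.of fun x y => ∏ j, g j (pairEquiv e _ x j) (pairEquiv e _ y j)

lemma pairLayer_mul (e : Fin m × Fin 2 ≃ Fin n) (g h : Fin m → Gate2) :
    pairLayer e g * pairLayer e h = pairLayer e (fun j => g j * h j) := by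
  ext x y
  simp only [pairLayer, Matrix.mul_apply, Matrix.of_apply, ← Finset.prod_mul_distrib]
  rw [Fintype.prod_sum]
  exact Fintype.sum_equiv (pairEquiv e _) _ _ fun z => rfl

lemma pairLayer_conjTranspose (e : Fin m × Fin 2 ≃ Fin n) (g : Fin m → Gate2) :
    (pairLayer e g)ᴴ = pairLayer e (fun j => (g j)ᴴ) := by
  ext x y
  simp [pairLayer, Matrix.conjTranspose_apply]

lemma pairLayer_one (e : Fin m × Fin 2 ≃ Fin n) : pairLayer e (fun _ => 1) = 1 := by
  ext x y
  by_cases h : x = y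
  · subst h
    rw [Matrix.one_apply_eq]
    change ∏ j, (1 : Gate2) (pairEquiv e _ x j) (pairEquiv e _ x j) = 1
    simp only [Matrix.one_apply_eq, Finset.prod_const_one]
  · have : ∃ j, pairEquiv e _ x j ≠ pairEquiv e _ y j := by
      by_contra! hc
      exact h ((pairEquiv e _).injective (funext hc))
    obtain ⟨j, hj⟩ := this
    rw [Matrix.one_apply_ne h]
    exact Finset.prod_eq_zero (Finset.mem_univ j) (Matrix.one_apply_ne hj)

lemma pauliString_eq_pairLayer (e : Fin m × Fin 2 ≃ Fin n) (α : Fin n → Fin 4) :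
    pauliString α = pairLayer e (fun j => pauli2 (pairEquiv e _ α j)) := by
  ext x y
  simp only [pauliString, pairLayer, Matrix.of_apply, prod_pairs e]
  rfl

lemma conjTranspose_pauliString_conj (e : Fin m × Fin 2 ≃ Fin n) (g : Fin m → Gate2)
    (α : Fin n → Fin 4) :
    (pairLayer e g)ᴴ * pauliString α * pairLayer e g =
      pairLayer e (fun j => conjPauli (pairEquiv e _ α j) (g j)) := by
  rw [pauliString_eq_pairLayer e, pairLayer_conjTranspose, pairLayer_mul, pairLayer_mul]
  rfl

lemma pairLayer_mem_unitary (e : Fin m × Fin 2 ≃ Fin n) (g : Fin m → Gate2)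
    (hg : ∀ j, g j ∈ Matrix.unitaryGroup (Fin 2 × Fin 2) ℂ) :
    pairLayer e g ∈ Matrix.unitaryGroup (QIdx n) ℂ := by
  rw [Matrix.mem_unitaryGroup_iff, Matrix.star_eq_conjTranspose, pairLayer_conjTranspose,
    pairLayer_mul, ← pairLayer_one e]
  congr 1
  funext j
  exact Matrix.mem_unitaryGroup_iff.mp (hg j)

lemma zeroExp_eq_sum (C A : Matrix (QIdx n) (QIdx n) ℂ) :
    zeroExp C A = ∑ x : QIdx n × QIdx n,
      star (C x.1 (allZero n)) * C x.2 (allZero n) * A x.1 x.2 := by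
  simp only [zeroExp, Matrix.mul_apply, Finset.sum_mul]
  rw [Fintype.sum_prod_type_right]
  refine Finset.sum_congr rfl fun j _ => ?_
  refine Finset.sum_congr rfl fun i _ => ?_
  rw [Matrix.conjTranspose_apply]
  ring

lemma zeroExp_mul (L C A : Matrix (QIdx n) (QIdx n) ℂ) :
    zeroExp (L * C) A = zeroExp C (Lᴴ * A * L) := by
  simp only [zeroExp, Matrix.conjTranspose_mul, Matrix.mul_assoc]

lemma zeroExp_pairLayer_sq (e : Fin m × Fin 2 ≃ Fin n) (C : Matrix (QIdx n) (QIdx n) ℂ)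
    (W : Fin m → Gate2) :
    zeroExp C (pairLayer e W) ^ 2 = ∑ x : QIdx n × QIdx n, ∑ y : QIdx n × QIdx n,
      (star (C x.1 (allZero n)) * C x.2 (allZero n)) *
        (star (C y.1 (allZero n)) * C y.2 (allZero n)) *
      ∏ j, (W j (pairEquiv e _ x.1 j) (pairEquiv e _ x.2 j) *
        W j (pairEquiv e _ y.1 j) (pairEquiv e _ y.2 j)) := by
  rw [sq, zeroExp_eq_sum, Finset.sum_mul_sum]
  refine Finset.sum_congr rfl fun x _ => ?_
  refine Finset.sum_congr rfl fun y _ => ?_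
  rw [mul_mul_mul_comm, Finset.prod_mul_distrib]
  rfl

/-- Transition kernel on Pauli strings induced by a layer of Haar-random gates. -/
def layerKer (e : Fin m × Fin 2 ≃ Fin n) (α β : Fin n → Fin 4) : ℝ :=
  ∏ j, gateKer (pairEquiv e _ α j) (pairEquiv e _ β j)

lemma integral_zeroExp_layer_sq (μ : Measure U4) [μ.IsHaarMeasure] [IsProbabilityMeasure μ]
    (e : Fin m × Fin 2 ≃ Fin n) (C : Matrix (QIdx n) (QIdx n) ℂ) (α : Fin n → Fin 4) :
    ∫ g : Fin m → U4, zeroExp (pairLayer e (fun j => (g j : Gate2)) * C) (pauliString α) ^ 2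
        ∂(Measure.pi fun _ => μ) =
      ∑ β, (layerKer e α β : ℂ) * zeroExp C (pauliString β) ^ 2 := by
  simp_rw [zeroExp_mul, conjTranspose_pauliString_conj, zeroExp_pairLayer_sq]
  have hint : ∀ x y : QIdx n × QIdx n, Integrable (fun g : Fin m → U4 =>
      ∏ j, (conjPauli (pairEquiv e _ α j) (g j : Gate2)
          (pairEquiv e _ x.1 j) (pairEquiv e _ x.2 j) *
        conjPauli (pairEquiv e _ α j) (g j : Gate2)
          (pairEquiv e _ y.1 j) (pairEquiv e _ y.2 j))) (Measure.pi fun _ => μ) := fun x y =>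
    Integrable.fintype_prod fun j => integrable_conjPauli_mul μ _ _ _ _ _
  rw [integral_finsetSum _ fun x _ => integrable_finsetSum _ fun y _ => (hint x y).const_mul _]
  have hin : ∀ x y : QIdx n × QIdx n, ∫ g : Fin m → U4,
      ∏ j, (conjPauli (pairEquiv e _ α j) (g j : Gate2)
          (pairEquiv e _ x.1 j) (pairEquiv e _ x.2 j) *
        conjPauli (pairEquiv e _ α j) (g j : Gate2)
          (pairEquiv e _ y.1 j) (pairEquiv e _ y.2 j)) ∂(Measure.pi fun _ => μ) =
      ∑ β, (layerKer e α β : ℂ) * ∏ j, (pauli2 (pairEquiv e _ β j)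
          (pairEquiv e _ x.1 j) (pairEquiv e _ x.2 j) *
        pauli2 (pairEquiv e _ β j) (pairEquiv e _ y.1 j) (pairEquiv e _ y.2 j)) := by
    intro x y
    rw [integral_fintype_prod_eq_prod (fun j (U : U4) => conjPauli (pairEquiv e _ α j) (U : Gate2)
          (pairEquiv e _ x.1 j) (pairEquiv e _ x.2 j) *
        conjPauli (pairEquiv e _ α j) (U : Gate2)
          (pairEquiv e _ y.1 j) (pairEquiv e _ y.2 j))]
    simp_rw [integral_conjPauli_mul_eq_gateKer]
    rw [Fintype.prod_sum]
    refine (Fintype.sum_equiv (pairEquiv e _) _ _ fun β => ?_).symm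
    rw [layerKer, Complex.ofReal_prod, ← Finset.prod_mul_distrib]
  simp_rw [integral_finsetSum _ fun y _ => (hint _ y).const_mul _, integral_const_mul, hin]
  simp_rw [pauliString_eq_pairLayer e, zeroExp_pairLayer_sq, Finset.mul_sum]
  refine Eq.trans (Finset.sum_congr rfl fun x _ => Finset.sum_comm) (Finset.sum_comm.trans ?_)
  refine Finset.sum_congr rfl fun β _ => ?_
  refine Finset.sum_congr rfl fun x _ => ?_
  refine Finset.sum_congr rfl fun y _ => ?_
  ring

end Layer

/-- The pairing of the `2 * m` ring sites used by brickwork layer `t`. -/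
def brickPairing (m t : ℕ) : Fin m × Fin 2 ≃ Fin (2 * m) :=
  Equiv.ofBijective
    (fun p => ⟨(2 * p.1.1 + p.2.1 + t % 2) % (2 * m), Nat.mod_lt _ (by have := p.1.2; omega)⟩) (by
      rw [Fintype.bijective_iff_injective_and_card]
      refine ⟨?_, by simp [mul_comm]⟩
      rintro ⟨⟨i, hi⟩, ⟨a, ha⟩⟩ ⟨⟨j, hj⟩, ⟨b, hb⟩⟩ h
      have ht : t % 2 < 2 := Nat.mod_lt _ (by norm_num)
      simp only [Fin.mk.injEq] at h
      have key : ∀ x, x ≤ 2 * m → x % (2 * m) = if x = 2 * m then 0 else x := by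
        intro x hx
        split_ifs with hxm
        · rw [hxm, Nat.mod_self]
        · exact Nat.mod_eq_of_lt (by omega)
      rw [key _ (by omega), key _ (by omega)] at h
      simp only [Prod.mk.injEq, Fin.mk.injEq]
      split_ifs at h <;> omega)

lemma brickPairing_val (m t : ℕ) (j : Fin m) (b : Fin 2) :
    (brickPairing m t (j, b)).1 = (2 * j.1 + b.1 + t % 2) % (2 * m) := rfl

lemma brickLayer_eq_pairLayer {m : ℕ} (t : ℕ) (g : Fin m → Gate2) :
    brickLayer t g = pairLayer (brickPairing m t) g := by
  have ht : t % 2 = 0 ∨ t % 2 = 1 := Nat.mod_two_eq_zero_or_one t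
  rcases ht with ht | ht
  · have h0 : ∀ j : Fin m, brickPairing m t (j, 0) = ⟨2 * j.1, by have := j.2; omega⟩ := by
      intro j
      ext
      rw [brickPairing_val, ht]
      exact Nat.mod_eq_of_lt (by have := j.2; simp)
    have h1 : ∀ j : Fin m, brickPairing m t (j, 1) = ⟨2 * j.1 + 1, by have := j.2; omega⟩ := by
      intro j
      ext
      rw [brickPairing_val, ht]
      exact Nat.mod_eq_of_lt (by have := j.2; simp; omega)
    simp only [brickLayer, ht, if_true, layerOdd, pairLayer, pairEquiv, Equiv.coe_fn_mk, h0, h1]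
  · have h0 : ∀ j : Fin m, brickPairing m t (j, 0) = ⟨2 * j.1 + 1, by have := j.2; omega⟩ := by
      intro j
      ext
      rw [brickPairing_val, ht]
      exact Nat.mod_eq_of_lt (by have := j.2; simp; omega)
    have h1 : ∀ j : Fin m, brickPairing m t (j, 1) =
        ⟨(2 * j.1 + 2) % (2 * m), Nat.mod_lt _ (by have := j.2; omega)⟩ := by
      intro j
      ext
      rw [brickPairing_val, ht]
      rfl
    simp only [brickLayer, ht, one_ne_zero, if_false, layerEven, pairLayer, pairEquiv,
      Equiv.coe_fn_mk, h0, h1]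

lemma circuitOf_succ {m l : ℕ} (G : GateAssign m (l + 1)) :
    circuitOf G = brickLayer l (G (Fin.last l)) * circuitOf fun t => G t.castSucc := by
  simp [circuitOf, List.finRange_succ_last, List.foldl_append, List.foldl_map]

lemma circuitOf_mem_unitary {m l : ℕ} (G : GateAssign m l)
    (hG : ∀ t j, G t j ∈ Matrix.unitaryGroup (Fin 2 × Fin 2) ℂ) :
    circuitOf G ∈ Matrix.unitaryGroup (QIdx (2 * m)) ℂ := by
  induction l with
  | zero => exact one_mem _
  | succ l ih =>
    rw [circuitOf_succ, brickLayer_eq_pairLayer]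
    exact mul_mem (pairLayer_mem_unitary _ _ fun j => hG _ j) (ih _ fun t j => hG _ j)

lemma measurable_circuitOf {Ω : Type*} [MeasurableSpace Ω] {m l : ℕ} (G : Ω → GateAssign m l)
    (hG : ∀ t j a b, Measurable fun ω => G ω t j a b) (x y : QIdx (2 * m)) :
    Measurable fun ω => circuitOf (G ω) x y := by
  induction l generalizing x y with
  | zero => exact measurable_const
  | succ l ih =>
    simp_rw [circuitOf_succ, brickLayer_eq_pairLayer, Matrix.mul_apply, pairLayer,
      Matrix.of_apply]
    exact Finset.measurable_fun_sum _ fun z _ =>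
      (Finset.measurable_fun_prod _ fun j _ => hG _ _ _ _).mul (ih _ (fun t j => hG _ j) z y)

lemma pauliString_conjTranspose {n : ℕ} (α : Fin n → Fin 4) :
    (pauliString α)ᴴ = pauliString α := by
  ext x y
  rw [Matrix.conjTranspose_apply, pauliString, Matrix.of_apply, Matrix.of_apply, star_prod]
  refine Finset.prod_congr rfl fun i _ => ?_
  rw [← Matrix.conjTranspose_apply, Pauli_conjTranspose]

lemma normSq_zeroExp {n : ℕ} (C : Matrix (QIdx n) (QIdx n) ℂ) (α : Fin n → Fin 4) :
    (Complex.normSq (zeroExp C (pauliString α)) : ℂ) = zeroExp C (pauliString α) ^ 2 := by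
  have h : star (zeroExp C (pauliString α)) = zeroExp C (pauliString α) := by
    rw [zeroExp, ← Matrix.conjTranspose_apply, Matrix.conjTranspose_mul, Matrix.conjTranspose_mul,
      Matrix.conjTranspose_conjTranspose, pauliString_conjTranspose, Matrix.mul_assoc]
  rw [← Complex.mul_conj, sq]
  exact congrArg _ h

lemma measurable_zeroExp_circuitOf {m l : ℕ} (α : Fin (2 * m) → Fin 4) :
    Measurable fun ω : Fin l × Fin m → U4 =>
      zeroExp (circuitOf (gatesOf ω)) (pauliString α) := by
  have h : ∀ x y, Measurable fun ω : Fin l × Fin m → U4 => circuitOf (gatesOf ω) x y :=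
    measurable_circuitOf _ fun t j a b =>
      (measurable_gate_entry a b).comp (measurable_pi_apply (t, j))
  simp_rw [zeroExp_eq_sum]
  exact Finset.measurable_fun_sum _ fun x _ =>
    ((continuous_star.measurable.comp (h _ _)).mul (h _ _)).mul_const _

lemma pauliString_mem_unitary {m : ℕ} (α : Fin (2 * m) → Fin 4) :
    pauliString α ∈ Matrix.unitaryGroup (QIdx (2 * m)) ℂ := by
  rw [pauliString_eq_pairLayer (brickPairing m 0)]
  exact pairLayer_mem_unitary _ _ fun j => pauli2_mem_unitary _

lemma norm_zeroExp_circuitOf_le {m l : ℕ} (α : Fin (2 * m) → Fin 4) (ω : Fin l × Fin m → U4) :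
    ‖zeroExp (circuitOf (gatesOf ω)) (pauliString α)‖ ≤ 1 := by
  have hC : circuitOf (gatesOf ω) ∈ Matrix.unitaryGroup (QIdx (2 * m)) ℂ :=
    circuitOf_mem_unitary _ fun t j => (ω (t, j)).2
  exact entry_norm_bound_of_unitary
    (mul_mem (mul_mem (Unitary.star_mem hC) (pauliString_mem_unitary α)) hC) _ _

lemma integrable_zeroExp_sq (μ : Measure U4) [IsProbabilityMeasure μ] {m l : ℕ}
    (α : Fin (2 * m) → Fin 4) :
    Integrable (fun ω : Fin l × Fin m → U4 =>
      zeroExp (circuitOf (gatesOf ω)) (pauliString α) ^ 2) (Measure.pi fun _ => μ) := by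
  refine Integrable.of_bound (C := 1)
    ((measurable_zeroExp_circuitOf α).pow_const 2).aestronglyMeasurable
    (Filter.Eventually.of_forall fun ω => ?_)
  rw [norm_pow]
  exact pow_le_one₀ (norm_nonneg _) (norm_zeroExp_circuitOf_le α ω)

/-- The second moment of the expectation of a Pauli string in a depth-`l` random circuit state. -/
def pauliMoment (μ : Measure U4) (m l : ℕ) (α : Fin (2 * m) → Fin 4) : ℝ :=
  ∫ ω : Fin l × Fin m → U4,
    Complex.normSq (zeroExp (circuitOf (gatesOf ω)) (pauliString α)) ∂(Measure.pi fun _ => μ)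

lemma ofReal_pauliMoment (μ : Measure U4) (m l : ℕ) (α : Fin (2 * m) → Fin 4) :
    (pauliMoment μ m l α : ℂ) = ∫ ω : Fin l × Fin m → U4,
      zeroExp (circuitOf (gatesOf ω)) (pauliString α) ^ 2 ∂(Measure.pi fun _ => μ) := by
  rw [pauliMoment, ← integral_complex_ofReal]
  simp_rw [normSq_zeroExp]

lemma pauliMoment_nonneg (μ : Measure U4) (m l : ℕ) (α : Fin (2 * m) → Fin 4) :
    0 ≤ pauliMoment μ m l α :=
  integral_nonneg fun _ => Complex.normSq_nonneg _

/-- Splitting off the last layer of gate positions. -/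
def lastLayerEquiv (m l : ℕ) : (Fin l × Fin m) ⊕ Fin m ≃ Fin (l + 1) × Fin m where
  toFun := Sum.elim (fun p => (p.1.castSucc, p.2)) fun j => (Fin.last l, j)
  invFun p := Fin.lastCases (motive := fun _ => (Fin l × Fin m) ⊕ Fin m)
    (Sum.inr p.2) (fun t => Sum.inl (t, p.2)) p.1
  left_inv p := by rcases p with ⟨t, j⟩ | j <;> simp
  right_inv p := by
    obtain ⟨t, j⟩ := p
    induction t using Fin.lastCases <;> simp

/-- Joining the gates of the first `l` layers with the gates of the last layer. -/
def joinLastLayer (m l : ℕ) :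
    (Fin l × Fin m → U4) × (Fin m → U4) ≃ᵐ (Fin (l + 1) × Fin m → U4) :=
  (MeasurableEquiv.sumPiEquivProdPi fun _ => U4).symm.trans
    (MeasurableEquiv.piCongrLeft (fun _ => U4) (lastLayerEquiv m l))

lemma measurePreserving_joinLastLayer (μ : Measure U4) [IsProbabilityMeasure μ] (m l : ℕ) :
    MeasurePreserving (joinLastLayer m l)
      ((Measure.pi fun _ => μ).prod (Measure.pi fun _ => μ)) (Measure.pi fun _ => μ) :=
  (measurePreserving_piCongrLeft (fun _ => μ) (lastLayerEquiv m l)).comp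
    (measurePreserving_sumPiEquivProdPi_symm fun _ => μ)

lemma joinLastLayer_castSucc {m l : ℕ} (a : Fin l × Fin m → U4) (g : Fin m → U4) (t : Fin l)
    (j : Fin m) : joinLastLayer m l (a, g) (t.castSucc, j) = a (t, j) :=
  MeasurableEquiv.piCongrLeft_apply_apply (β := fun _ => U4) (lastLayerEquiv m l)
    ((MeasurableEquiv.sumPiEquivProdPi fun _ => U4).symm (a, g)) (Sum.inl (t, j))

lemma joinLastLayer_last {m l : ℕ} (a : Fin l × Fin m → U4) (g : Fin m → U4)
    (j : Fin m) : joinLastLayer m l (a, g) (Fin.last l, j) = g j :=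
  MeasurableEquiv.piCongrLeft_apply_apply (β := fun _ => U4) (lastLayerEquiv m l)
    ((MeasurableEquiv.sumPiEquivProdPi fun _ => U4).symm (a, g)) (Sum.inr j)

lemma circuitOf_joinLastLayer {m l : ℕ} (a : Fin l × Fin m → U4) (g : Fin m → U4) :
    circuitOf (gatesOf (joinLastLayer m l (a, g))) =
      pairLayer (brickPairing m l) (fun j => (g j : Gate2)) * circuitOf (gatesOf a) := by
  have hlast : gatesOf (joinLastLayer m l (a, g)) (Fin.last l) = fun j => (g j : Gate2) :=
    funext fun j => congrArg Subtype.val (joinLastLayer_last a g j)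
  have hinit : (fun t : Fin l => gatesOf (joinLastLayer m l (a, g)) t.castSucc) = gatesOf a :=
    funext fun t => funext fun j => congrArg Subtype.val (joinLastLayer_castSucc a g t j)
  rw [circuitOf_succ, brickLayer_eq_pairLayer, hlast, hinit]

lemma pauliMoment_succ (μ : Measure U4) [μ.IsHaarMeasure] [IsProbabilityMeasure μ] (m l : ℕ)
    (α : Fin (2 * m) → Fin 4) :
    pauliMoment μ m (l + 1) α =
      ∑ β, layerKer (brickPairing m l) α β * pauliMoment μ m l β := by
  apply Complex.ofReal_injective
  push_cast
  simp_rw [ofReal_pauliMoment]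
  rw [← (measurePreserving_joinLastLayer μ m l).integral_comp', integral_prod]
  · simp_rw [circuitOf_joinLastLayer, integral_zeroExp_layer_sq]
    rw [integral_finsetSum _ fun β _ => (integrable_zeroExp_sq μ β).const_mul _]
    simp_rw [integral_const_mul]
  · exact (measurePreserving_joinLastLayer μ m l).integrable_comp_of_integrable
      (integrable_zeroExp_sq μ α)

lemma pauliMoment_zero (μ : Measure U4) [IsProbabilityMeasure μ] (m : ℕ)
    (α : Fin (2 * m) → Fin 4) :
    pauliMoment μ m 0 α = ∏ i, Complex.normSq (Pauli (α i) 0 0) := by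
  have h : ∀ ω : Fin 0 × Fin m → U4, circuitOf (gatesOf ω) = 1 := fun ω => rfl
  simp [pauliMoment, h, zeroExp, pauliString, allZero]

/-- Indicator that the Pauli label `a` is allowed at a site, where `r` tells whether the site belongs
to the region. -/
def siteInd (r : Bool) (a : Fin 4) : ℝ := if r = true ∨ a = 0 then 1 else 0

/-- Probability that a pair of sites with region labels `r`, `s` receives the common label `b`. -/
def pairWeight (r s b : Bool) : ℝ :=
  if r = s then (if b = r then 1 else 0) else if b then 1 / 5 else 4 / 5

lemma pairWeight_nonneg (r s b : Bool) : 0 ≤ pairWeight r s b := by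
  unfold pairWeight
  split_ifs <;> norm_num

lemma sum_siteInd_gateKer (r s : Bool) (q : Fin 4 × Fin 4) :
    ∑ p : Fin 4 × Fin 4, siteInd r p.1 * siteInd s p.2 * gateKer p q =
      ∑ b, pairWeight r s b * (siteInd b q.1 * siteInd b q.2) := by
  obtain ⟨q1, q2⟩ := q
  rw [Fintype.sum_prod_type]
  cases r <;> cases s <;> fin_cases q1 <;> fin_cases q2 <;>
    simp [siteInd, pairWeight, gateKer, Fin.sum_univ_four] <;>
    first | rfl | norm_num

section Region

variable {n m : ℕ}

/-- Indicator that a Pauli string is supported in the region `R`. -/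
def suppInd (R : Fin n → Bool) (α : Fin n → Fin 4) : ℝ := ∏ i, siteInd (R i) (α i)

/-- The region formed by the pairs selected by `η`. -/
def pairRegion (e : Fin m × Fin 2 ≃ Fin n) (η : Fin m → Bool) : Fin n → Bool :=
  fun i => η (e.symm i).1

lemma pairRegion_apply (e : Fin m × Fin 2 ≃ Fin n) (η : Fin m → Bool) (j : Fin m) (b : Fin 2) :
    pairRegion e η (e (j, b)) = η j := by
  simp [pairRegion]

/-- The probability that the region `R` is turned into the union of the pairs selected by `η`. -/
def regionWeight (e : Fin m × Fin 2 ≃ Fin n) (R : Fin n → Bool) (η : Fin m → Bool) : ℝ :=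
  ∏ j, pairWeight (R (e (j, 0))) (R (e (j, 1))) (η j)

lemma regionWeight_nonneg (e : Fin m × Fin 2 ≃ Fin n) (R : Fin n → Bool) (η : Fin m → Bool) :
    0 ≤ regionWeight e R η :=
  Finset.prod_nonneg fun _ _ => pairWeight_nonneg _ _ _

lemma sum_suppInd_layerKer (e : Fin m × Fin 2 ≃ Fin n) (R : Fin n → Bool) (β : Fin n → Fin 4) :
    ∑ α, suppInd R α * layerKer e α β = ∑ η, regionWeight e R η * suppInd (pairRegion e η) β := by
  have hl : ∑ α, suppInd R α * layerKer e α β = ∏ j, ∑ p : Fin 4 × Fin 4,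
      siteInd (R (e (j, 0))) p.1 * siteInd (R (e (j, 1))) p.2 *
        gateKer p (pairEquiv e _ β j) := by
    rw [Fintype.prod_sum]
    refine Fintype.sum_equiv (pairEquiv e _) _ _ fun α => ?_
    rw [suppInd, prod_pairs e, layerKer, ← Finset.prod_mul_distrib]
    rfl
  rw [hl]
  simp_rw [sum_siteInd_gateKer]
  rw [Fintype.prod_sum]
  refine Finset.sum_congr rfl fun η _ => ?_
  rw [suppInd, prod_pairs e, regionWeight, ← Finset.prod_mul_distrib]
  simp only [pairRegion_apply]
  rfl

/-- The weight `c ^ |R|` of a region. -/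
def regionPot (c : ℝ) (R : Fin n → Bool) : ℝ := ∏ i, if R i then c else 1

lemma regionPot_nonneg {c : ℝ} (hc : 0 ≤ c) (R : Fin n → Bool) : 0 ≤ regionPot c R :=
  Finset.prod_nonneg fun _ _ => by split_ifs <;> positivity

lemma regionPot_pairRegion (c : ℝ) (e : Fin m × Fin 2 ≃ Fin n) (η : Fin m → Bool) :
    regionPot c (pairRegion e η) = ∏ j, if η j then c * c else 1 := by
  rw [regionPot, prod_pairs e]
  refine Finset.prod_congr rfl fun j _ => ?_
  rw [pairRegion_apply, pairRegion_apply]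
  cases η j <;> simp

lemma sum_regionWeight_mul_regionPot (c : ℝ) (e : Fin m × Fin 2 ≃ Fin n) (R : Fin n → Bool) :
    ∑ η, regionWeight e R η * regionPot c (pairRegion e η) =
      ∏ j, ∑ b, pairWeight (R (e (j, 0))) (R (e (j, 1))) b * (if b then c * c else 1) := by
  rw [Fintype.prod_sum]
  refine Finset.sum_congr rfl fun η _ => ?_
  rw [regionPot_pairRegion, regionWeight, ← Finset.prod_mul_distrib]

lemma sum_regionWeight (e : Fin m × Fin 2 ≃ Fin n) (R : Fin n → Bool) :
    ∑ η, regionWeight e R η = 1 := by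
  simp_rw [regionWeight]
  rw [← Fintype.prod_sum]
  refine Finset.prod_eq_one fun j _ => ?_
  cases R (e (j, 0)) <;> cases R (e (j, 1)) <;> norm_num [pairWeight]

lemma sum_regionWeight_mul_regionPot_four (e : Fin m × Fin 2 ≃ Fin n) (R : Fin n → Bool) :
    ∑ η, regionWeight e R η * regionPot 4 (pairRegion e η) = regionPot 4 R := by
  rw [sum_regionWeight_mul_regionPot, regionPot, prod_pairs e]
  refine Finset.prod_congr rfl fun j _ => ?_
  cases R (e (j, 0)) <;> cases R (e (j, 1)) <;> norm_num [pairWeight]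

lemma sum_regionWeight_mul_regionPot_two_le (e : Fin m × Fin 2 ≃ Fin n) (R : Fin n → Bool)
    (hR : ∃ j, R (e (j, 0)) ≠ R (e (j, 1))) :
    ∑ η, regionWeight e R η * regionPot 2 (pairRegion e η) ≤ 4 / 5 * regionPot 2 R := by
  obtain ⟨j₀, hj₀⟩ := hR
  rw [sum_regionWeight_mul_regionPot, regionPot, prod_pairs e,
    ← Finset.mul_prod_erase _ _ (Finset.mem_univ j₀),
    ← Finset.mul_prod_erase (Finset.univ) (fun j => (if R (e (j, 0)) then (2 : ℝ) else 1) *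
      if R (e (j, 1)) then 2 else 1) (Finset.mem_univ j₀), ← mul_assoc]
  refine mul_le_mul ?_ (Finset.prod_le_prod (fun j _ => ?_) fun j _ => ?_)
    (Finset.prod_nonneg fun j _ => ?_) ?_
  · revert hj₀
    cases R (e (j₀, 0)) <;> cases R (e (j₀, 1)) <;> norm_num [pairWeight]
  · cases R (e (j, 0)) <;> cases R (e (j, 1)) <;> norm_num [pairWeight]
  · cases R (e (j, 0)) <;> cases R (e (j, 1)) <;> norm_num [pairWeight]
  · cases R (e (j, 0)) <;> cases R (e (j, 1)) <;> norm_num [pairWeight]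
  · split_ifs <;> norm_num

lemma regionWeight_const (e : Fin m × Fin 2 ≃ Fin n) (r : Bool) (η : Fin m → Bool) :
    regionWeight e (fun _ => r) η = if η = fun _ => r then 1 else 0 := by
  simp only [regionWeight, pairWeight, if_true]
  split_ifs with h
  · simp [h]
  · obtain ⟨j, hj⟩ := Function.ne_iff.mp h
    exact Finset.prod_eq_zero (Finset.mem_univ j) (if_neg hj)

end Region

/-- Total second moment of the Pauli strings supported in the region `R`
(the average purity of `R`, up to normalization). -/
def regionMoment (μ : Measure U4) (m l : ℕ) (R : Fin (2 * m) → Bool) : ℝ :=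
  ∑ α, suppInd R α * pauliMoment μ m l α

lemma regionMoment_succ (μ : Measure U4) [μ.IsHaarMeasure] [IsProbabilityMeasure μ] (m l : ℕ)
    (R : Fin (2 * m) → Bool) :
    regionMoment μ m (l + 1) R = ∑ η, regionWeight (brickPairing m l) R η *
      regionMoment μ m l (pairRegion (brickPairing m l) η) := by
  simp_rw [regionMoment, pauliMoment_succ, Finset.mul_sum, ← mul_assoc]
  rw [Finset.sum_comm, Finset.sum_comm (s := (Finset.univ : Finset (Fin m → Bool)))]
  simp_rw [← Finset.sum_mul, sum_suppInd_layerKer]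

lemma regionMoment_zero (μ : Measure U4) [IsProbabilityMeasure μ] (m : ℕ)
    (R : Fin (2 * m) → Bool) : regionMoment μ m 0 R = regionPot 2 R := by
  simp_rw [regionMoment, pauliMoment_zero, suppInd, ← Finset.prod_mul_distrib]
  rw [← Fintype.prod_sum fun i a => siteInd (R i) a * Complex.normSq (Pauli a 0 0), regionPot]
  refine Finset.prod_congr rfl fun i _ => ?_
  cases R i <;> norm_num [siteInd, Pauli, Fin.sum_univ_four]

lemma regionMoment_const (μ : Measure U4) [μ.IsHaarMeasure] [IsProbabilityMeasure μ] (m l : ℕ)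
    (r : Bool) : regionMoment μ m l (fun _ => r) = regionPot 2 (fun _ : Fin (2 * m) => r) := by
  induction l with
  | zero => exact regionMoment_zero μ m _
  | succ l ih =>
    rw [regionMoment_succ, Finset.sum_eq_single fun _ => r]
    · rw [regionWeight_const, if_pos rfl, one_mul]
      exact ih
    · intro η _ hη
      rw [regionWeight_const, if_neg hη, zero_mul]
    · simp

lemma region_const_of_aligned {m : ℕ} (t : ℕ) (R : Fin (2 * m) → Bool)
    (h₀ : ∀ j, R (brickPairing m t (j, 0)) = R (brickPairing m t (j, 1)))
    (h₁ : ∀ j, R (brickPairing m (t + 1) (j, 0)) = R (brickPairing m (t + 1) (j, 1))) :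
    ∃ r, R = fun _ => r := by
  have aux : ∀ t : ℕ, (∀ j, R (brickPairing m t (j, 0)) = R (brickPairing m t (j, 1))) →
      ∀ i (hi : i + 1 < 2 * m), i % 2 = t % 2 → R ⟨i, by omega⟩ = R ⟨i + 1, hi⟩ := by
    intro t h i hi hit
    have hj : i / 2 < m := by omega
    have h0 : brickPairing m t (⟨i / 2, hj⟩, 0) = ⟨i, by omega⟩ := by
      ext
      rw [brickPairing_val]
      simp only [Fin.val_zero]
      rw [Nat.mod_eq_of_lt] <;> omega
    have h1 : brickPairing m t (⟨i / 2, hj⟩, 1) = ⟨i + 1, hi⟩ := by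
      ext
      rw [brickPairing_val]
      simp only [Fin.val_one]
      rw [Nat.mod_eq_of_lt] <;> omega
    rw [← h0, ← h1]
    exact h _
  have hstep : ∀ i (hi : i + 1 < 2 * m), R ⟨i, by omega⟩ = R ⟨i + 1, hi⟩ := by
    intro i hi
    by_cases hit : i % 2 = t % 2
    · exact aux t h₀ i hi hit
    · exact aux (t + 1) h₁ i hi (by omega)
  have hall : ∀ i (hi : i < 2 * m), R ⟨i, hi⟩ = R ⟨0, by omega⟩ := by
    intro i
    induction i with
    | zero => exact fun _ => rfl
    | succ i ih => exact fun hi => (hstep i hi).symm.trans (ih (by omega))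
  rcases Nat.eq_zero_or_pos (2 * m) with hm | hm
  · exact ⟨true, funext fun i => absurd i.2 (by omega)⟩
  · exact ⟨R ⟨0, hm⟩, funext fun i => hall i.1 i.2⟩

lemma regionMoment_const_le (μ : Measure U4) [μ.IsHaarMeasure] [IsProbabilityMeasure μ]
    (m l : ℕ) (r : Bool) :
    regionMoment μ m l (fun _ => r) ≤
      1 + (4 / 5) ^ l * regionPot 2 (fun _ : Fin (2 * m) => r) +
        regionPot 4 (fun _ : Fin (2 * m) => r) / 4 ^ m := by
  rw [regionMoment_const]
  cases r
  · have h1 (c : ℝ) : regionPot c (fun _ : Fin (2 * m) => false) = 1 := by simp [regionPot]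
    rw [h1, h1]
    have h2 : (0 : ℝ) ≤ (4 / 5) ^ l * 1 := by positivity
    have h3 : (0 : ℝ) ≤ 1 / 4 ^ m := by positivity
    change (1 : ℝ) ≤ _
    linarith
  · have h2 : regionPot 2 (fun _ : Fin (2 * m) => true) = 4 ^ m := by
      simp [regionPot, pow_mul]
      norm_num
    have h4 : regionPot 4 (fun _ : Fin (2 * m) => true) / 4 ^ m = 4 ^ m := by
      simp [regionPot, two_mul, pow_add]
    rw [h2, h4]
    have : (0 : ℝ) ≤ (4 / 5) ^ l * 4 ^ m := by positivity
    linarith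

lemma regionMoment_le (μ : Measure U4) [μ.IsHaarMeasure] [IsProbabilityMeasure μ] (m l : ℕ)
    (R : Fin (2 * m) → Bool)
    (hR : ∀ j, R (brickPairing m l (j, 0)) = R (brickPairing m l (j, 1))) :
    regionMoment μ m l R ≤ 1 + (4 / 5) ^ l * regionPot 2 R + regionPot 4 R / 4 ^ m := by
  induction l generalizing R with
  | zero =>
    rw [regionMoment_zero]
    have := regionPot_nonneg (c := 4) (by norm_num) R
    have : 0 ≤ regionPot 4 R / 4 ^ m := by positivity
    linarith
  | succ l ih =>
    by_cases hal : ∀ j, R (brickPairing m l (j, 0)) = R (brickPairing m l (j, 1))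
    · obtain ⟨r, rfl⟩ := region_const_of_aligned l R hal hR
      exact regionMoment_const_le μ m _ r
    · push Not at hal
      set e := brickPairing m l
      calc regionMoment μ m (l + 1) R
          ≤ ∑ η, regionWeight e R η * (1 + (4 / 5) ^ l * regionPot 2 (pairRegion e η) +
              regionPot 4 (pairRegion e η) / 4 ^ m) := by
            rw [regionMoment_succ]
            refine Finset.sum_le_sum fun η _ =>
              mul_le_mul_of_nonneg_left (ih _ fun j => ?_) (regionWeight_nonneg _ _ _)
            rw [pairRegion_apply, pairRegion_apply]
        _ = ∑ η, regionWeight e R η +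
              (4 / 5) ^ l * ∑ η, regionWeight e R η * regionPot 2 (pairRegion e η) +
              (∑ η, regionWeight e R η * regionPot 4 (pairRegion e η)) / 4 ^ m := by
            rw [Finset.mul_sum, Finset.sum_div, ← Finset.sum_add_distrib, ← Finset.sum_add_distrib]
            refine Finset.sum_congr rfl fun η _ => ?_
            ring
        _ ≤ 1 + (4 / 5) ^ l * (4 / 5 * regionPot 2 R) + regionPot 4 R / 4 ^ m := by
            rw [sum_regionWeight, sum_regionWeight_mul_regionPot_four]
            gcongr
            exact sum_regionWeight_mul_regionPot_two_le e R hal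
        _ = 1 + (4 / 5) ^ (l + 1) * regionPot 2 R + regionPot 4 R / 4 ^ m := by ring

lemma layerKer_single {n m : ℕ} (e : Fin m × Fin 2 ≃ Fin n) (i : Fin n) (β : Fin n → Fin 4) :
    layerKer e (fun k => if k = i then 1 else 0) β =
      (suppInd (pairRegion e fun j => decide (j = (e.symm i).1)) β -
        suppInd (fun _ => false) β) / 15 := by
  obtain ⟨⟨j₀, b₀⟩, rfl⟩ := e.surjective i
  rw [layerKer, suppInd, suppInd, prod_pairs e, prod_pairs e,
    ← Finset.mul_prod_erase _ _ (Finset.mem_univ j₀),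
    ← Finset.mul_prod_erase (Finset.univ) (fun j => siteInd _ _ * siteInd _ _)
      (Finset.mem_univ j₀),
    ← Finset.mul_prod_erase (Finset.univ) (fun j => siteInd false _ * siteInd false _)
      (Finset.mem_univ j₀)]
  have h1 : ∀ j ∈ Finset.univ.erase j₀,
      gateKer (pairEquiv e _ (fun k => if k = e (j₀, b₀) then 1 else 0) j) (pairEquiv e _ β j) =
        siteInd false (β (e (j, 0))) * siteInd false (β (e (j, 1))) := by
    intro j hj
    have hj := Finset.ne_of_mem_erase hj
    simp [pairEquiv, gateKer, siteInd, hj, Prod.ext_iff, ite_and]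
    split_ifs <;> rfl
  have h2 : ∀ j ∈ Finset.univ.erase j₀,
      siteInd (pairRegion e (fun j => decide (j = (e.symm (e (j₀, b₀))).1)) (e (j, 0)))
          (β (e (j, 0))) *
        siteInd (pairRegion e (fun j => decide (j = (e.symm (e (j₀, b₀))).1)) (e (j, 1)))
          (β (e (j, 1))) =
        siteInd false (β (e (j, 0))) * siteInd false (β (e (j, 1))) := by
    intro j hj
    have hj := Finset.ne_of_mem_erase hj
    simp [pairRegion_apply, hj]
  rw [Finset.prod_congr rfl h1, Finset.prod_congr rfl h2, ← sub_mul, mul_div_right_comm]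
  congr 1
  have h3 : pairEquiv e _ (fun k => if k = e (j₀, b₀) then (1 : Fin 4) else 0) j₀ ≠ 0 := by
    fin_cases b₀ <;> simp [pairEquiv, Prod.ext_iff]
  rw [gateKer, if_neg h3]
  simp [pairRegion_apply, pairEquiv, siteInd, Prod.ext_iff, ite_and]
  split_ifs <;> norm_num

lemma pauliMoment_single_succ (μ : Measure U4) [μ.IsHaarMeasure] [IsProbabilityMeasure μ]
    (m l : ℕ) (i : Fin (2 * m)) :
    pauliMoment μ m (l + 1) (fun k => if k = i then 1 else 0) =
      (regionMoment μ m l (pairRegion (brickPairing m l) fun j =>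
        decide (j = ((brickPairing m l).symm i).1)) - 1) / 15 := by
  have h1 : regionMoment μ m l (fun _ => false) = 1 := by
    rw [regionMoment_const]
    simp [regionPot]
  rw [pauliMoment_succ, ← h1, regionMoment, regionMoment, ← Finset.sum_sub_distrib,
    Finset.sum_div]
  refine Finset.sum_congr rfl fun β _ => ?_
  rw [layerKer_single]
  ring

lemma regionPot_single {n m : ℕ} (c : ℝ) (e : Fin m × Fin 2 ≃ Fin n) (j₀ : Fin m) :
    regionPot c (pairRegion e fun j => decide (j = j₀)) = c * c := by
  rw [regionPot_pairRegion]
  simp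

lemma pauliMoment_single_succ_le (μ : Measure U4) [μ.IsHaarMeasure] [IsProbabilityMeasure μ]
    (m l : ℕ) (i : Fin (2 * m)) :
    pauliMoment μ m (l + 1) (fun k => if k = i then 1 else 0) ≤
      (4 * (4 / 5) ^ l + 16 / 4 ^ m) / 15 := by
  have h := regionMoment_le μ m l (pairRegion (brickPairing m l) fun j =>
    decide (j = ((brickPairing m l).symm i).1)) fun j => by
      rw [pairRegion_apply, pairRegion_apply]
  rw [regionPot_single, regionPot_single] at h
  rw [pauliMoment_single_succ]
  gcongr
  norm_num at h
  linarith

lemma pauliMoment_single_one (μ : Measure U4) [μ.IsHaarMeasure] [IsProbabilityMeasure μ]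
    (m : ℕ) (i : Fin (2 * m)) :
    pauliMoment μ m 1 (fun k => if k = i then 1 else 0) = 1 / 5 := by
  rw [pauliMoment_single_succ, regionMoment_zero, regionPot_single]
  norm_num

lemma sum_pauliMoment_single_le (μ : Measure U4) [μ.IsHaarMeasure] [IsProbabilityMeasure μ]
    (m d : ℕ) (hd : d ≤ 2 ^ (2 * m)) (i : Fin (2 * m)) :
    ∑ l ∈ Finset.Icc 1 d, pauliMoment μ m l (fun k => if k = i then 1 else 0) ≤ 12 / 5 := by
  have hd' : (d : ℝ) ≤ 4 ^ m := by
    have : ((d : ℕ) : ℝ) ≤ ((2 ^ (2 * m) : ℕ) : ℝ) := by exact_mod_cast hd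
    rw [pow_mul] at this
    exact_mod_cast this
  have hgeom : ∑ l ∈ Finset.range d, (4 / 5 : ℝ) ^ l ≤ 5 := by
    rw [geom_sum_eq (by norm_num)]
    have : (0 : ℝ) ≤ (4 / 5) ^ d := by positivity
    norm_num
    linarith
  have hdiv : (d : ℝ) * (16 / 4 ^ m) ≤ 16 := by
    rw [mul_div_assoc', div_le_iff₀ (by positivity)]
    linarith
  rw [← Finset.Ico_succ_right_eq_Icc, Finset.sum_Ico_eq_sum_range]
  calc _ ≤ ∑ l ∈ Finset.range d, (4 * (4 / 5) ^ l + 16 / 4 ^ m : ℝ) / 15 := by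
        simp only [Order.succ_eq_add_one, Nat.add_sub_cancel]
        refine Finset.sum_le_sum fun l _ => ?_
        rw [add_comm 1 l]
        exact pauliMoment_single_succ_le μ m l i
    _ = (4 * ∑ l ∈ Finset.range d, (4 / 5 : ℝ) ^ l + d * (16 / 4 ^ m)) / 15 := by
        rw [← Finset.sum_div, Finset.sum_add_distrib, ← Finset.mul_sum, Finset.sum_const,
          Finset.card_range, nsmul_eq_mul]
    _ ≤ 12 / 5 := by linarith

/-- **The cumulative first-order error contribution is bounded by a universal constant.**
There is a universal constant `C₀ > 0` such that for every even `n = 2m ≥ 2` and every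
`1 ≤ d ≤ 2^n`, `Σ_{l=1}^{d} E_{C∼RQC(n,l)} |⟨0^n| C† X₁ C |0^n⟩|² ≤ C₀`, and moreover
this sum is at least `1/5` (its `l = 1` term). -/
theorem cumulative_first_order_error_bounded :
    ∃ C₀ : ℝ, 0 < C₀ ∧
      ∀ (m d : ℕ) (hm : 1 ≤ m) (hd1 : 1 ≤ d) (hd2 : d ≤ 2 ^ (2 * m))
        (μ : Measure U4) [μ.IsHaarMeasure] [IsProbabilityMeasure μ],
        (∑ l ∈ Finset.Icc 1 d,
            ∫ ω : Fin l × Fin m → U4,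
              Complex.normSq
                  (zeroExp (circuitOf (gatesOf ω)) (pauliXat ⟨0, by omega⟩))
              ∂(Measure.pi fun _ => μ)) ≤ C₀
        ∧ (1 / 5 : ℝ) ≤
            ∑ l ∈ Finset.Icc 1 d,
              ∫ ω : Fin l × Fin m → U4,
                Complex.normSq
                    (zeroExp (circuitOf (gatesOf ω)) (pauliXat ⟨0, by omega⟩))
                ∂(Measure.pi fun _ => μ) := by
  refine ⟨12 / 5, by norm_num, ?_⟩
  intro m d hm hd1 hd2 μ _ _
  refine ⟨sum_pauliMoment_single_le μ m d hd2 ⟨0, by omega⟩, ?_⟩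
  rw [← pauliMoment_single_one μ m ⟨0, by omega⟩]
  exact Finset.single_le_sum (f := fun l => pauliMoment μ m l fun k =>
    if k = ⟨0, by omega⟩ then 1 else 0) (fun l _ => pauliMoment_nonneg μ m l _)
    (Finset.mem_Icc.mpr ⟨le_rfl, hd1⟩)

end
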